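/- Let p = rur. Then for every n ≥ 1 the number of Dyck paths of semilength n avoiding p equals Σ_{i=0}^{n−1} (−1)^i · C_{n−i} · C(n−1, i), where C_k is the k-th Catalan number; that is, s_p(n, n) = Σ_{i=0}^{n−1} (−1)^i C_{n−i} C(n−1, i). -/

import Mathlib

/-- A step of a lattice path: `u` (up) or `r` (right). -/
inductive Step : Type
  | u : Step
  | r : Step
deriving DecidableEq

/-- A word over the alphabet `{u, r}`. -/
abbrev Word := List Step

/-- The number of letters `r` in a word. -/
def countR (w : Word) : ℕ := w.count Step.r

/-- The number of letters `u` in a word. -/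
def countU (w : Word) : ℕ := w.count Step.u

/-- `dval q` = (number of `r`'s in `q`) - (number of `u`'s in `q`). -/
def dval (w : Word) : ℤ := (countR w : ℤ) - (countU w : ℤ)

/-- A pattern is depth-zero if every suffix `q` of it satisfies `dval q ≥ 0`. -/
def DepthZero (p : Word) : Prop := ∀ q : Word, q <:+ p → 0 ≤ dval q

/-- `o` is a bifix of `p`: a nonempty proper prefix of `p` that is also a (proper) suffix. -/
def IsBifix (o p : Word) : Prop := o ≠ [] ∧ o ≠ p ∧ o <+: p ∧ o <:+ p

/-- A pattern is bifix-free if it has no bifix. -/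
def BifixFree (p : Word) : Prop := ∀ o : Word, ¬ IsBifix o p

/-- `w` is a ballot path to the lattice point `(n, m)`: it has exactly `n` letters `r`
and `m` letters `u`, and every prefix has at least as many `u`'s as `r`'s. -/
def IsBallot (w : Word) (n m : ℤ) : Prop :=
  (countR w : ℤ) = n ∧ (countU w : ℤ) = m ∧
    ∀ t : Word, t <+: w → countR t ≤ countU t

/-- `w` avoids the pattern `p`: `p` does not occur in `w` as a contiguous substring. -/
def Avoids (p w : Word) : Prop := ¬ p <:+: w

/-- `s p n m` is the number of ballot paths to `(n, m)` avoiding `p`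
(`0` if `n < 0`, `m < 0`, or `m < n`, since then no such path exists). -/
noncomputable def s (p : Word) (n m : ℤ) : ℕ :=
  Set.ncard {w : Word | IsBallot w n m ∧ Avoids p w}

/-- The pattern `rur`. -/
def rur : Word := [Step.r, Step.u, Step.r]

open PowerSeries BinaryTree in
/-- The generating function of a multiplicative statistic on binary trees. -/
theorem mk_sum_treesOfNumNodesEq (F G H : BinaryTree Unit → ℤ)
    (h : ∀ l r, F (.node () l r) = G l * H r) :
    (mk fun n => ∑ t ∈ treesOfNumNodesEq n, F t) =
      C (F .nil) + X * ((mk fun n => ∑ t ∈ treesOfNumNodesEq n, G t) *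
        mk fun n => ∑ t ∈ treesOfNumNodesEq n, H t) := by
  ext n
  cases n with
  | zero => simp
  | succ n =>
    rw [map_add, coeff_succ_X_mul, coeff_C, if_neg n.succ_ne_zero, zero_add, coeff_mul, coeff_mk,
      treesOfNumNodesEq_succ, Finset.sum_biUnion]
    · refine Finset.sum_congr rfl fun ij _ => ?_
      rw [Finset.sum_map, Finset.sum_product, coeff_mk, coeff_mk, Finset.sum_mul_sum]
      exact Finset.sum_congr rfl fun l _ => Finset.sum_congr rfl fun r _ => h l r
    · simp_rw [Set.PairwiseDisjoint, Set.Pairwise, Finset.disjoint_left]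
      aesop

open PowerSeries

/-- The power series of `1 / (1 + X)`. -/
noncomputable def invOneAdd : ℤ⟦X⟧ := rescale (-1) (mk 1)

theorem one_add_X_mul_invOneAdd : (1 + X) * invOneAdd = 1 := by
  have h := congrArg (rescale (-1 : ℤ)) (mk_one_mul_one_sub_eq_one ℤ)
  rw [map_mul, map_sub, map_one, rescale_X, map_neg, map_one] at h
  rw [invOneAdd]
  linear_combination h

theorem coeff_invOneAdd_pow (d n : ℕ) :
    coeff n (invOneAdd ^ (d + 1)) = (-1) ^ n * ((d + n).choose d : ℤ) := by
  rw [invOneAdd, ← map_pow, mk_one_pow_eq_mk_choose_add, coeff_rescale, coeff_mk]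

theorem hasSubst_X_mul_invOneAdd : HasSubst (X * invOneAdd) :=
  HasSubst.of_constantCoeff_zero' (by simp)

/-- The integral Catalan series evaluated at `X / (1 + X)`. -/
noncomputable def catalanSubst : ℤ⟦X⟧ :=
  (catalanSeries.map (Nat.castRingHom ℤ)).subst (X * invOneAdd)

theorem catalanSubst_eq : catalanSubst = 1 + X * invOneAdd * catalanSubst ^ 2 := by
  have h := congrArg (PowerSeries.map (Nat.castRingHom ℤ)) catalanSeries_sq_mul_X_add_one
  have hs := hasSubst_X_mul_invOneAdd
  have h' := congrArg (substAlgHom (R := ℤ) hs) h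
  simp only [map_add, map_mul, map_pow, map_one, PowerSeries.map_X, substAlgHom_X] at h'
  rw [coe_substAlgHom] at h'
  change catalanSubst ^ 2 * _ + 1 = catalanSubst at h'
  linear_combination -h'

theorem coeff_catalanSubst (m : ℕ) :
    coeff (m + 1) catalanSubst = ∑ i ∈ Finset.range (m + 1),
      (-1 : ℤ) ^ i * (catalan (m + 1 - i) : ℤ) * (m.choose i : ℤ) := by
  have key (k : ℕ) : coeff (m + 1) ((X * invOneAdd) ^ (k + 1)) =
      if k ≤ m then (-1) ^ (m - k) * (m.choose k : ℤ) else 0 := by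
    rw [mul_pow, coeff_X_pow_mul']
    by_cases hk : k ≤ m
    · rw [if_pos hk, if_pos (by omega), Nat.add_sub_add_right, coeff_invOneAdd_pow,
        Nat.add_sub_cancel' hk]
    · rw [if_neg hk, if_neg (by omega)]
  rw [catalanSubst, coeff_subst' hasSubst_X_mul_invOneAdd,
    finsum_eq_sum_of_support_subset (s := Finset.range (m + 2)), Finset.sum_range_succ',
    ← Finset.sum_range_reflect]
  · rw [pow_zero, coeff_one, if_neg m.succ_ne_zero, smul_zero, add_zero]
    refine Finset.sum_congr rfl fun i hi => ?_
    have hi : i ≤ m := Nat.lt_succ_iff.mp (Finset.mem_range.mp hi)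
    rw [key, if_pos (by omega), show m + 1 - 1 - i + 1 = m + 1 - i by omega,
      show m + 1 - 1 - i = m - i by omega, Nat.sub_sub_self hi, Nat.choose_symm hi]
    simp only [coeff_map, catalanSeries_coeff, smul_eq_mul, eq_natCast]
    ring
  · intro k hk
    by_contra hk'
    simp only [Finset.coe_range, Set.mem_Iio, not_lt] at hk'
    obtain ⟨k, rfl⟩ : ∃ j, k = j + 1 := ⟨k - 1, by omega⟩
    exact hk (by simp only [key]; rw [if_neg (by omega), smul_zero])

open BinaryTree

/-- The Dyck path coded by a binary tree. -/
def treeWord : BinaryTree Unit → Word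
  | .nil => []
  | .node _ l r => Step.u :: (treeWord l ++ Step.r :: treeWord r)

theorem treeWord_eq_nil_or (t : BinaryTree Unit) :
    treeWord t = [] ∨ ∃ a, treeWord t = a ++ [Step.r] := by
  induction t with
  | nil => exact .inl rfl
  | node _ l r _ ih =>
    right
    rcases ih with h | ⟨a, h⟩
    · exact ⟨Step.u :: treeWord l, by simp [treeWord, h]⟩
    · exact ⟨Step.u :: (treeWord l ++ Step.r :: a), by simp [treeWord, h]⟩

theorem ur_prefix_treeWord_iff (t : BinaryTree Unit) :
    [Step.u, Step.r] <+: treeWord t ↔ ∃ r, t = .node () .nil r := by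
  rcases t with _ | ⟨_, l, r⟩
  · simp [treeWord]
  · rcases l with _ | ⟨_, _, _⟩ <;> simp [treeWord]

theorem avoids_rur_u_cons (w : Word) : Avoids rur (Step.u :: w) ↔ Avoids rur w := by
  simp [Avoids, rur, List.infix_cons_iff]

theorem avoids_rur_r_cons (w : Word) :
    Avoids rur (Step.r :: w) ↔ ¬ [Step.u, Step.r] <+: w ∧ Avoids rur w := by
  simp [Avoids, rur, List.infix_cons_iff]

theorem avoids_rur_append_r_r (a b : Word) :
    Avoids rur (a ++ Step.r :: Step.r :: b) ↔
      Avoids rur (a ++ [Step.r]) ∧ Avoids rur (Step.r :: b) := by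
  induction a with
  | nil =>
    rw [List.nil_append, List.nil_append, avoids_rur_r_cons]
    simp [Avoids, rur, List.infix_cons_iff]
  | cons x a ih =>
    cases x
    · simpa [avoids_rur_u_cons] using ih
    · rw [List.cons_append, List.cons_append, avoids_rur_r_cons, avoids_rur_r_cons, ih, and_assoc]
      refine and_congr_left fun _ => not_congr ?_
      rcases a with _ | ⟨y, _ | ⟨z, a⟩⟩ <;> simp

theorem avoids_rur_treeWord_node (l r : BinaryTree Unit) :
    Avoids rur (treeWord (.node () l r)) ↔
      Avoids rur (treeWord l) ∧ ¬ [Step.u, Step.r] <+: treeWord r ∧ Avoids rur (treeWord r) := by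
  rw [treeWord, avoids_rur_u_cons, ← avoids_rur_r_cons]
  rcases treeWord_eq_nil_or l with h | ⟨a, h⟩
  · simp [h, Avoids, rur]
  · rw [h, List.append_assoc, List.singleton_append, avoids_rur_append_r_r]

/-- The letter of `Step` corresponding to a `DyckStep`. -/
def stepOfDyckStep : DyckStep → Step
  | .U => .u
  | .D => .r

theorem stepOfDyckStep_injective : Function.Injective stepOfDyckStep := by
  rintro (_ | _) (_ | _) h <;> simp_all [stepOfDyckStep]

theorem stepOfDyckStep_surjective : Function.Surjective stepOfDyckStep
  | .u => ⟨.U, rfl⟩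
  | .r => ⟨.D, rfl⟩

theorem treeWord_eq_map (t : BinaryTree Unit) :
    treeWord t = (DyckWord.ofTree t).toList.map stepOfDyckStep := by
  induction t with
  | nil => rfl
  | node _ l r ihl ihr =>
    change _ = List.map stepOfDyckStep
      (([DyckStep.U] ++ (DyckWord.ofTree l).toList ++ [DyckStep.D]) ++ (DyckWord.ofTree r).toList)
    simp [treeWord, ihl, ihr, stepOfDyckStep]

theorem treeWord_injective : Function.Injective treeWord := fun s t h => by
  rw [treeWord_eq_map, treeWord_eq_map] at h
  exact DyckWord.equivTree.symm.injective
    (DyckWord.ext (stepOfDyckStep_injective.list_map h))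

theorem countU_map (w : List DyckStep) : countU (w.map stepOfDyckStep) = w.count .U :=
  List.count_map_of_injective w _ stepOfDyckStep_injective DyckStep.U

theorem countR_map (w : List DyckStep) : countR (w.map stepOfDyckStep) = w.count .D :=
  List.count_map_of_injective w _ stepOfDyckStep_injective DyckStep.D

theorem isBallot_iff_exists_treeWord (w : Word) (n : ℕ) :
    IsBallot w n n ↔ ∃ t, t.numNodes = n ∧ treeWord t = w := by
  constructor
  · obtain ⟨v, rfl⟩ := stepOfDyckStep_surjective.list_map w
    rintro ⟨hR, hU, hp⟩
    rw [countR_map] at hR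
    rw [countU_map] at hU
    let p : DyckWord := ⟨v, by omega, fun i => by
      have := hp ((v.take i).map stepOfDyckStep) ((List.take_prefix i v).map _)
      rwa [countR_map, countU_map] at this⟩
    refine ⟨p.toTree, ?_, ?_⟩
    · rw [DyckWord.numNodes_toTree]
      exact_mod_cast hU
    · rw [treeWord_eq_map, DyckWord.ofTree_toTree]
  · rintro ⟨t, rfl, rfl⟩
    have ht : (DyckWord.ofTree t).semilength = t.numNodes := by
      rw [← DyckWord.numNodes_toTree, DyckWord.toTree_ofTree]
    rw [treeWord_eq_map]
    refine ⟨?_, ?_, fun q hq => ?_⟩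
    · rw [countR_map, ← DyckWord.semilength_eq_count_D, ht]
    · rw [countU_map, ← ht, DyckWord.semilength]
    · rw [List.prefix_iff_eq_take.mp hq, ← List.map_take, countR_map, countU_map]
      exact DyckWord.count_D_le_count_U _ _

open Classical in
theorem s_rur_eq_sum (n : ℕ) :
    (s rur n n : ℤ) =
      ∑ t ∈ treesOfNumNodesEq n, if Avoids rur (treeWord t) then 1 else 0 := by
  rw [← Finset.sum_filter, Finset.sum_const, nsmul_one, Nat.cast_inj, s,
    ← Finset.card_image_of_injective _ treeWord_injective, ← Set.ncard_coe_finset]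
  congr 1
  ext w
  simp only [Set.mem_ofPred_eq, isBallot_iff_exists_treeWord, Finset.coe_image, Set.mem_image,
    Finset.coe_filter, mem_treesOfNumNodesEq]
  constructor
  · rintro ⟨⟨t, ht, rfl⟩, h⟩
    exact ⟨t, ⟨ht, h⟩, rfl⟩
  · rintro ⟨t, ⟨ht, h⟩, rfl⟩
    exact ⟨⟨t, ht, rfl⟩, h⟩

open Classical in
theorem mk_s_rur : (mk fun n : ℕ => (s rur n n : ℤ)) = catalanSubst := by
  let A : BinaryTree Unit → ℤ := fun t => if Avoids rur (treeWord t) then 1 else 0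
  let B : BinaryTree Unit → ℤ := fun t => if [Step.u, Step.r] <+: treeWord t then 0 else A t
  let Z : BinaryTree Unit → ℤ := fun t => if t = .nil then 1 else 0
  let gf : (BinaryTree Unit → ℤ) → ℤ⟦X⟧ := fun F => mk fun n => ∑ t ∈ treesOfNumNodesEq n, F t
  have hnil : Avoids rur [] := by simp [Avoids, rur]
  have hA₀ : A .nil = 1 := if_pos hnil
  have hnode (l r) : A (.node () l r) = A l * B r := by
    simp only [A, B, avoids_rur_treeWord_node]
    split_ifs <;> simp_all
  have hA : gf A = 1 + X * (gf A * gf B) := by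
    have h := mk_sum_treesOfNumNodesEq A A B hnode
    rwa [hA₀, map_one] at h
  have hZ : gf Z = 1 := by
    ext n
    simp only [gf, Z, coeff_mk, coeff_one, Finset.sum_ite_eq', mem_treesOfNumNodesEq,
      numNodes, eq_comm]
  have hD : gf (A - B) = X * gf B := by
    have h := mk_sum_treesOfNumNodesEq (A - B) Z B fun l r => by
      simp only [Pi.sub_apply, B, Z, ur_prefix_treeWord_iff, hnode]
      rcases l with _ | ⟨_, _, _⟩
      · simp [A, treeWord, hnil]
      · simp
    change gf (A - B) = _ + X * (gf Z * gf B) at h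
    rw [hZ, one_mul] at h
    simpa [A, B, treeWord] using h
  have hsub : gf (A - B) = gf A - gf B := by
    ext n
    simp [gf]
  have hE := one_add_X_mul_invOneAdd
  have hB : gf B = invOneAdd * gf A := by
    linear_combination (-gf B) * hE + invOneAdd * (hsub - hD)
  have hgf : gf A = 1 + X * invOneAdd * gf A ^ 2 := by
    rw [hB] at hA
    linear_combination hA
  have hS : (mk fun n : ℕ => (s rur n n : ℤ)) = gf A := by
    ext n
    rw [coeff_mk, s_rur_eq_sum, coeff_mk]
  rw [hS]
  have hmul : (gf A - catalanSubst) * (1 - X * (invOneAdd * (gf A + catalanSubst))) = 0 := by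
    linear_combination hgf - catalanSubst_eq
  rcases mul_eq_zero.mp hmul with h | h
  · exact sub_eq_zero.mp h
  · simpa using congrArg constantCoeff h

/-- The number of Dyck paths of semilength `n ≥ 1` avoiding `rur` equals
`∑_{i=0}^{n-1} (-1)^i C_{n-i} C(n-1, i)`, where `C_k` is the `k`-th Catalan number. -/
theorem dyck_avoiding_rur_catalan (n : ℕ) (hn : 1 ≤ n) :
    (s rur n n : ℤ) =
      ∑ i ∈ Finset.range n,
        (-1 : ℤ) ^ i * (catalan (n - i) : ℤ) * (Nat.choose (n - 1) i : ℤ) := by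
  obtain ⟨m, rfl⟩ := Nat.exists_eq_add_of_le' hn
  have h := congrArg (coeff (m + 1)) mk_s_rur
  rwa [coeff_mk, coeff_catalanSubst] at h
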